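/- Let K ⊆ H be a Hopf subalgebra of a semisimple Hopf algebra over an algebraically closed field of characteristic zero, with two-sided integrals Λ_H = Λ_K Λ, normalized traces t_H ∈ H*, t_K ∈ K* restricting compatibly. Then the components of the dual bases tensor for the Frobenius extension H|K multiply to the index: S(Λ_{(2)}) Λ_{(1)} = ε(Λ) = ε(Λ_H)/ε(Λ_K) = dim H / dim K. -/

import Mathlib

open TensorProduct Coalgebra HopfAlgebra

namespace HopfAlgebra

section Convolution

variable {k C A : Type*} [Field k] [AddCommGroup C] [Module k C]
  [Ring A] [Algebra k A]

variable (A) in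
/-- A linear functional on `C`, viewed as a map into the scalars of `A`. -/
noncomputable def scalarMap (p : C →ₗ[k] k) : C →ₗ[k] A := Algebra.linearMap k A ∘ₗ p

@[simp]
lemma scalarMap_apply (p : C →ₗ[k] k) (a : C) : scalarMap A p a = algebraMap k A (p a) := rfl

lemma scalarMap_self (p : C →ₗ[k] k) : scalarMap k p = p := rfl

lemma dual_ext {a b : C} (h : ∀ p : C →ₗ[k] k, p a = p b) : a = b := by
  rw [← sub_eq_zero, ← Module.forall_dual_apply_eq_zero_iff k]
  intro p
  rw [map_sub, h p, sub_self]

variable [Coalgebra k C]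

/-- The convolution product of two linear maps from a coalgebra to an algebra. -/
noncomputable def conv (f g : C →ₗ[k] A) : C →ₗ[k] A :=
  LinearMap.mul' k A ∘ₗ TensorProduct.map f g ∘ₗ comul

local infixl:70 "⋆" => conv

lemma conv_apply (f g : C →ₗ[k] A) (a : C) :
    (f ⋆ g) a = ∑ i ∈ (ℛ k a).index, f ((ℛ k a).left i) * g ((ℛ k a).right i) := by
  simp only [conv, LinearMap.comp_apply]
  conv_lhs => rw [← (ℛ k a).eq]
  simp

lemma conv_assoc (f g h : C →ₗ[k] A) : f ⋆ g ⋆ h = f ⋆ (g ⋆ h) :=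
  congrArg WithConv.ofConv (mul_assoc (WithConv.toConv f) (WithConv.toConv g) (WithConv.toConv h))

lemma conv_counit (f : C →ₗ[k] A) : f ⋆ scalarMap A counit = f :=
  congrArg WithConv.ofConv (mul_one (WithConv.toConv f))

lemma counit_conv (f : C →ₗ[k] A) : scalarMap A counit ⋆ f = f :=
  congrArg WithConv.ofConv (one_mul (WithConv.toConv f))

/-- The right hit action `h ↦ h₍₁₎ p(h₍₂₎)`. -/
noncomputable def hitR (p : C →ₗ[k] k) : C →ₗ[k] C :=
  (TensorProduct.rid k C).toLinearMap ∘ₗ p.lTensor C ∘ₗ comul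

/-- The left hit action `h ↦ p(h₍₁₎) h₍₂₎`. -/
noncomputable def hitL (p : C →ₗ[k] k) : C →ₗ[k] C :=
  (TensorProduct.lid k C).toLinearMap ∘ₗ p.rTensor C ∘ₗ comul

lemma hitR_apply (p : C →ₗ[k] k) (a : C) :
    hitR p a = ∑ i ∈ (ℛ k a).index, p ((ℛ k a).right i) • (ℛ k a).left i := by
  simp only [hitR, LinearMap.comp_apply]
  conv_lhs => rw [← (ℛ k a).eq]
  simp

lemma hitL_apply (p : C →ₗ[k] k) (a : C) :
    hitL p a = ∑ i ∈ (ℛ k a).index, p ((ℛ k a).left i) • (ℛ k a).right i := by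
  simp only [hitL, LinearMap.comp_apply]
  conv_lhs => rw [← (ℛ k a).eq]
  simp

lemma comp_hitR (f : C →ₗ[k] A) (p : C →ₗ[k] k) : f ∘ₗ hitR p = f ⋆ scalarMap A p := by
  ext a
  simp [conv_apply, hitR_apply, Algebra.smul_def, Algebra.commutes]

lemma comp_hitL (f : C →ₗ[k] A) (p : C →ₗ[k] k) : f ∘ₗ hitL p = scalarMap A p ⋆ f := by
  ext a
  simp [conv_apply, hitL_apply, Algebra.smul_def]

lemma dual_hitR (q p : C →ₗ[k] k) (a : C) : q (hitR p a) = p (hitL q a) := by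
  have h1 := comp_hitR q p
  have h2 := comp_hitL p q
  rw [scalarMap_self] at h1 h2
  exact LinearMap.congr_fun (h1.trans h2.symm) a

@[simp]
lemma hitR_counit (a : C) : hitR (counit (R := k)) a = a := by
  simp [hitR]

@[simp]
lemma hitL_counit (a : C) : hitL (counit (R := k)) a = a := by
  simp [hitL]

lemma hitR_add (p q : C →ₗ[k] k) : hitR (p + q) = hitR p + hitR q := by
  ext a; simp [hitR]

lemma hitR_smul (c : k) (p : C →ₗ[k] k) : hitR (c • p) = c • hitR p := by
  ext a; simp [hitR]

lemma hitL_smul (c : k) (p : C →ₗ[k] k) : hitL (c • p) = c • hitL p := by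
  ext a; simp [hitL]

variable (k C) in
/-- The right hit action as a linear map in the functional. -/
noncomputable def hitRLinear : (C →ₗ[k] k) →ₗ[k] C →ₗ[k] C where
  toFun := hitR
  map_add' := hitR_add
  map_smul' := hitR_smul

@[simp]
lemma hitRLinear_apply (p : C →ₗ[k] k) : hitRLinear k C p = hitR p := rfl

lemma hitR_hitR (q p : C →ₗ[k] k) (a : C) : hitR q (hitR p a) = hitR (q ∘ₗ hitR p) a := by
  refine dual_ext (k := k) fun f => ?_
  have h := conv_assoc f q p
  have h1 := comp_hitR (f ∘ₗ hitR q) p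
  have h2 := comp_hitR f q
  have h3 := comp_hitR f (q ∘ₗ hitR p)
  have h4 := comp_hitR q p
  rw [scalarMap_self] at h1 h2 h3 h4
  have h5 : (f ∘ₗ hitR q) ∘ₗ hitR p = f ∘ₗ hitR (q ∘ₗ hitR p) := by rw [h1, h2, h3, h4, h]
  exact LinearMap.congr_fun h5 a

lemma hitL_hitL (p q : C →ₗ[k] k) (a : C) : hitL p (hitL q a) = hitL (p ∘ₗ hitL q) a := by
  refine dual_ext (k := k) fun f => ?_
  have h1 := comp_hitL (f ∘ₗ hitL p) q
  have h2 := comp_hitL f p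
  have h3 := comp_hitL f (p ∘ₗ hitL q)
  have h4 := comp_hitL p q
  rw [scalarMap_self] at h1 h2 h3 h4
  have h5 : (f ∘ₗ hitL p) ∘ₗ hitL q = f ∘ₗ hitL (p ∘ₗ hitL q) := by
    rw [h1, h2, h3, h4, conv_assoc]
  exact LinearMap.congr_fun h5 a

lemma hitL_hitR (p q : C →ₗ[k] k) (a : C) : hitL p (hitR q a) = hitR q (hitL p a) := by
  refine dual_ext (k := k) fun f => ?_
  have h1 := comp_hitR (f ∘ₗ hitL p) q
  have h2 := comp_hitL f p
  have h3 := comp_hitL (f ∘ₗ hitR q) p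
  have h4 := comp_hitR f q
  rw [scalarMap_self] at h1 h2 h3 h4
  have h5 : (f ∘ₗ hitL p) ∘ₗ hitR q = (f ∘ₗ hitR q) ∘ₗ hitL p := by
    rw [h1, h2, h3, h4, conv_assoc]
  exact LinearMap.congr_fun h5 a

lemma comul_eq_sum_hitR {ι : Type*} [Fintype ι] (b : Module.Basis ι k C) (a : C) :
    comul (R := k) a = ∑ j, hitR (b.coord j) a ⊗ₜ[k] b j := by
  conv_lhs => rw [← (ℛ k a).eq]
  simp_rw [hitR_apply, TensorProduct.sum_tmul]
  rw [Finset.sum_comm]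
  refine Finset.sum_congr rfl fun i _ => ?_
  simp only [Module.Basis.coord_apply, TensorProduct.smul_tmul, ← TensorProduct.tmul_sum,
    b.sum_repr]

lemma comul_eq_sum_hitL {ι : Type*} [Fintype ι] (b : Module.Basis ι k C) (a : C) :
    comul (R := k) a = ∑ j, b j ⊗ₜ[k] hitL (b.coord j) a := by
  conv_lhs => rw [← (ℛ k a).eq]
  simp_rw [hitL_apply, TensorProduct.tmul_sum]
  rw [Finset.sum_comm]
  refine Finset.sum_congr rfl fun i _ => ?_
  simp only [Module.Basis.coord_apply, ← TensorProduct.smul_tmul, ← TensorProduct.sum_tmul,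
    b.sum_repr]

end Convolution

local infixl:70 "⋆" => conv

section Antipode

variable {k H : Type*} [Field k] [Ring H] [HopfAlgebra k H]

variable (k H) in
/-- The embedding `h ↦ h ⊗ 1`. -/
noncomputable abbrev inclL : H →ₐ[k] H ⊗[k] H := Algebra.TensorProduct.includeLeft

variable (k H) in
/-- The embedding `h ↦ 1 ⊗ h`. -/
noncomputable abbrev inclR : H →ₐ[k] H ⊗[k] H := Algebra.TensorProduct.includeRight

lemma comul_eq_conv : (comul : H →ₗ[k] H ⊗[k] H) =
    (inclL k H).toLinearMap ⋆ (inclR k H).toLinearMap := by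
  ext a
  rw [conv_apply]
  conv_lhs => rw [← (ℛ k a).eq]
  simp

lemma comm_comul_eq_conv : (TensorProduct.comm k H H).toLinearMap ∘ₗ comul =
    (inclR k H).toLinearMap ⋆ (inclL k H).toLinearMap := by
  ext a
  rw [conv_apply, LinearMap.comp_apply]
  conv_lhs => rw [← (ℛ k a).eq]
  simp

lemma antipode_conv {A : Type*} [Ring A] [Algebra k A] (φ : H →ₐ[k] A) :
    (φ.toLinearMap ∘ₗ antipode k) ⋆ φ.toLinearMap = scalarMap A counit := by
  ext a
  have h := congrArg φ (sum_antipode_mul_eq_algebraMap_counit (ℛ k a))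
  simpa [conv_apply] using h

lemma conv_antipode {A : Type*} [Ring A] [Algebra k A] (φ : H →ₐ[k] A) :
    φ.toLinearMap ⋆ (φ.toLinearMap ∘ₗ antipode k) = scalarMap A counit := by
  ext a
  have h := congrArg φ (sum_mul_antipode_eq_algebraMap_counit (ℛ k a))
  simpa [conv_apply] using h

lemma comul_conv_antipode : (comul : H →ₗ[k] H ⊗[k] H) ⋆
    ((inclR k H).toLinearMap ∘ₗ antipode k) = (inclL k H).toLinearMap := by
  rw [comul_eq_conv, conv_assoc, conv_antipode, conv_counit]

lemma antipode_conv_comul : ((inclL k H).toLinearMap ∘ₗ antipode k) ⋆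
    (comul : H →ₗ[k] H ⊗[k] H) = (inclR k H).toLinearMap := by
  rw [comul_eq_conv, ← conv_assoc, antipode_conv, counit_conv]

lemma comul_comp_antipode : (comul : H →ₗ[k] H ⊗[k] H) ∘ₗ antipode k =
    ((inclR k H).toLinearMap ∘ₗ antipode k) ⋆ ((inclL k H).toLinearMap ∘ₗ antipode k) := by
  have h1 : (comul : H →ₗ[k] H ⊗[k] H) ⋆ (comul ∘ₗ antipode k) = scalarMap _ counit :=
    conv_antipode (Bialgebra.comulAlgHom k H)
  rw [← counit_conv ((comul : H →ₗ[k] H ⊗[k] H) ∘ₗ antipode k), ← antipode_conv (inclR k H),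
    ← antipode_conv_comul, ← conv_assoc]
  conv_rhs => rw [← conv_counit (_ ⋆ _)]
  rw [conv_assoc, h1, antipode_conv_comul]

lemma antipode_hitR (q : H →ₗ[k] k) (h : H) :
    antipode k (hitR (q ∘ₗ antipode k) h) = hitL q (antipode k h) := by
  have h1 := LinearMap.congr_fun (comul_comp_antipode (k := k) (H := H)) h
  rw [LinearMap.comp_apply] at h1
  rw [hitL, LinearMap.comp_apply, LinearMap.comp_apply, h1, hitR_apply]
  simp [conv_apply]

lemma antipode_hitL (q : H →ₗ[k] k) (h : H) :
    antipode k (hitL (q ∘ₗ antipode k) h) = hitR q (antipode k h) := by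
  have h1 := LinearMap.congr_fun (comul_comp_antipode (k := k) (H := H)) h
  rw [LinearMap.comp_apply] at h1
  rw [hitR, LinearMap.comp_apply, LinearMap.comp_apply, h1, hitL_apply]
  simp [conv_apply]

end Antipode

section Integral

variable {k H : Type*} [Field k] [Ring H] [HopfAlgebra k H] {Λ : H}

lemma comul_mul_tmul_one (hΛ : ∀ a : H, Λ * a = counit (R := k) a • Λ) (h : H) :
    comul (R := k) Λ * (h ⊗ₜ[k] 1) = comul (R := k) Λ * (1 ⊗ₜ[k] antipode k h) := by
  have h1 := LinearMap.congr_fun (comul_conv_antipode (k := k) (H := H)) h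
  have h2 := sum_counit_smul (ℛ k h)
  rw [conv_apply] at h1
  simp only [AlgHom.toLinearMap_apply, Algebra.TensorProduct.includeLeft_apply,
    LinearMap.comp_apply, Algebra.TensorProduct.includeRight_apply] at h1
  rw [← h1, Finset.mul_sum]
  simp_rw [← mul_assoc, ← Bialgebra.comul_mul, hΛ, map_smul]
  conv_rhs => rw [← h2]
  simp only [map_sum, map_smul, TensorProduct.tmul_sum, Finset.mul_sum, TensorProduct.tmul_smul,
    mul_smul_comm, smul_mul_assoc]

lemma antipode_tmul_one_mul_comul (hΛ : ∀ a : H, a * Λ = counit (R := k) a • Λ) (h : H) :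
    (antipode k h ⊗ₜ[k] 1) * comul (R := k) Λ = (1 ⊗ₜ[k] h) * comul (R := k) Λ := by
  have h1 := LinearMap.congr_fun (antipode_conv_comul (k := k) (H := H)) h
  rw [conv_apply] at h1
  simp only [AlgHom.toLinearMap_apply, Algebra.TensorProduct.includeLeft_apply,
    LinearMap.comp_apply, Algebra.TensorProduct.includeRight_apply] at h1
  rw [← h1, Finset.sum_mul]
  simp_rw [mul_assoc, ← Bialgebra.comul_mul, hΛ, map_smul]
  have h2 := hitR_counit (k := k) h
  rw [hitR_apply] at h2
  conv_lhs => rw [← h2]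
  simp only [map_sum, map_smul, TensorProduct.sum_tmul, Finset.sum_mul,
    ← TensorProduct.smul_tmul', mul_smul_comm, smul_mul_assoc]

/-- `Λ₍₁₎ p(Λ₍₂₎ S(h)) = Λ₍₁₎ p(Λ₍₂₎) h`. -/
lemma hitR_comp_mulRight_antipode (hΛ : ∀ a : H, Λ * a = counit (R := k) a • Λ)
    (p : H →ₗ[k] k) (h : H) :
    hitR (p ∘ₗ LinearMap.mulRight k (antipode k h)) Λ = hitR p Λ * h := by
  have h1 := congrArg (fun t => TensorProduct.rid k H (p.lTensor H t)) (comul_mul_tmul_one hΛ h)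
  rw [← (ℛ k Λ).eq] at h1
  simpa [hitR_apply, Finset.sum_mul] using h1.symm

/-- `Λ₍₁₎ p(h Λ₍₂₎) = S(h) Λ₍₁₎ p(Λ₍₂₎)`. -/
lemma hitR_comp_mulLeft (hΛ : ∀ a : H, a * Λ = counit (R := k) a • Λ)
    (p : H →ₗ[k] k) (h : H) :
    hitR (p ∘ₗ LinearMap.mulLeft k h) Λ = antipode k h * hitR p Λ := by
  have h1 := congrArg (fun t => TensorProduct.rid k H (p.lTensor H t))
    (antipode_tmul_one_mul_comul hΛ h)
  rw [← (ℛ k Λ).eq] at h1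
  simpa [hitR_apply, Finset.mul_sum] using h1.symm

variable [FiniteDimensional k H]

lemma exists_hitR_eq_one (hΛ : ∀ a : H, Λ * a = counit (R := k) a • Λ)
    (hε : counit (R := k) Λ ≠ 0) : ∃ p : H →ₗ[k] k, hitR p Λ = 1 := by
  let b := Module.finBasis k H
  refine ⟨(counit (R := k) Λ)⁻¹ •
    ∑ j, b.coord j ∘ₗ LinearMap.mulRight k (antipode k (antipode k (b j))), ?_⟩
  have h1 : hitR (k := k) (∑ j, b.coord j ∘ₗ LinearMap.mulRight k (antipode k (antipode k (b j)))) Λ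
      = counit (R := k) Λ • 1 := by
    have h2 := congrArg (fun t => LinearMap.mul' k H ((antipode k).lTensor H t))
      (comul_eq_sum_hitR b Λ)
    rw [mul_antipode_lTensor_comul_apply] at h2
    rw [← hitRLinear_apply, map_sum, LinearMap.sum_apply]
    simp only [hitRLinear_apply, hitR_comp_mulRight_antipode hΛ]
    simpa [Algebra.algebraMap_eq_smul_one] using h2.symm
  rw [hitR_smul, LinearMap.smul_apply, h1, smul_smul, inv_mul_cancel₀ hε, one_smul]

end Integral

section DualIntegral

variable {k H : Type*} [Field k] [Ring H] [HopfAlgebra k H] {Λ : H} {l : H →ₗ[k] k}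

lemma hitR_one (q : H →ₗ[k] k) : hitR q (1 : H) = q 1 • 1 := by
  simp [hitR, Algebra.TensorProduct.one_def]

lemma hitL_one (q : H →ₗ[k] k) : hitL q (1 : H) = q 1 • 1 := by
  simp [hitL, Algebra.TensorProduct.one_def]

lemma hitR_mulRight_antipode_eq (hr : ∀ a : H, Λ * a = counit (R := k) a • Λ)
    (hl1 : hitR l Λ = 1) (h : H) : hitR (l ∘ₗ LinearMap.mulRight k (antipode k h)) Λ = h := by
  rw [hitR_comp_mulRight_antipode hr, hl1, one_mul]

lemma antipode_injective (hr : ∀ a : H, Λ * a = counit (R := k) a • Λ)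
    (hl1 : hitR l Λ = 1) : Function.Injective (antipode k (A := H)) := by
  intro a b hab
  rw [← hitR_mulRight_antipode_eq hr hl1 a, hab, hitR_mulRight_antipode_eq hr hl1]

lemma hitR_mulLeft_eq (hl : ∀ a : H, a * Λ = counit (R := k) a • Λ)
    (hl1 : hitR l Λ = 1) (h : H) : hitR (l ∘ₗ LinearMap.mulLeft k h) Λ = antipode k h := by
  rw [hitR_comp_mulLeft hl, hl1, mul_one]

lemma eq_zero_of_forall_dual_integral_mul (hl : ∀ a : H, a * Λ = counit (R := k) a • Λ)
    (hr : ∀ a : H, Λ * a = counit (R := k) a • Λ)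
    (hl1 : hitR l Λ = 1) {h : H} (hh : ∀ a, l (h * a) = 0) : h = 0 := by
  have h1 : l ∘ₗ LinearMap.mulLeft k h = 0 := by ext a; simpa using hh a
  have h2 := hitR_mulLeft_eq hl hl1 h
  rw [h1, ← hitRLinear_apply, map_zero, LinearMap.zero_apply] at h2
  exact antipode_injective hr hl1 (by rw [← h2, map_zero])

variable [FiniteDimensional k H]

lemma antipode_bijective (hr : ∀ a : H, Λ * a = counit (R := k) a • Λ)
    (hl1 : hitR l Λ = 1) : Function.Bijective (antipode k (A := H)) :=
  ⟨antipode_injective hr hl1,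
    LinearMap.surjective_of_injective (antipode_injective hr hl1)⟩

lemma eq_of_hitR_eq (hr : ∀ a : H, Λ * a = counit (R := k) a • Λ)
    (hl1 : hitR l Λ = 1) {p q : H →ₗ[k] k} (h : hitR p Λ = hitR q Λ) : p = q := by
  let F : (H →ₗ[k] k) →ₗ[k] H := (LinearMap.applyₗ Λ) ∘ₗ hitRLinear k H
  have hs : Function.Surjective F := fun x => ⟨_, hitR_mulRight_antipode_eq hr hl1 x⟩
  have hi : Function.Injective F :=
    (LinearMap.injective_iff_surjective_of_finrank_eq_finrank
      (Subspace.dual_finrank_eq (K := k) (V := H))).2 hs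
  exact hi h

/-- The functional dual to an integral is a left integral. -/
lemma hitR_dual_integral (hr : ∀ a : H, Λ * a = counit (R := k) a • Λ)
    (hl1 : hitR l Λ = 1) (h : H) : hitR l h = l h • 1 := by
  refine dual_ext (k := k) fun q => ?_
  have h1 : q ∘ₗ hitR l = q 1 • l := by
    refine eq_of_hitR_eq hr hl1 ?_
    rw [← hitR_hitR, hl1, hitR_one, hitR_smul, LinearMap.smul_apply, hl1]
  have h2 := LinearMap.congr_fun h1 h
  simpa [mul_comm] using h2

lemma left_integral_unique (hr : ∀ a : H, Λ * a = counit (R := k) a • Λ)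
    (hl1 : hitR l Λ = 1) {μ : H →ₗ[k] k} (hμ : ∀ h, hitR μ h = μ h • 1) :
    ∃ c : k, μ = c • l := by
  have hx : hitR μ Λ = counit (R := k) (hitR μ Λ) • 1 := by
    refine dual_ext (k := k) fun q => ?_
    have h1 : q ∘ₗ hitR μ = q 1 • μ := by
      ext h
      simp [hμ, mul_comm]
    have h2 : hitR q (hitR μ Λ) = q 1 • hitR μ Λ := by
      rw [hitR_hitR, h1, hitR_smul, LinearMap.smul_apply]
    have h3 := congrArg (counit (R := k)) h2
    rw [dual_hitR, hitL_counit] at h3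
    rw [h3]
    simp [mul_comm]
  refine ⟨counit (R := k) (hitR μ Λ), eq_of_hitR_eq hr hl1 ?_⟩
  rw [hitR_smul, LinearMap.smul_apply, hl1]
  exact hx

lemma right_integral_unique (hr : ∀ a : H, Λ * a = counit (R := k) a • Λ)
    (hl1 : hitR l Λ = 1) {ν : H →ₗ[k] k} (hν : ∀ h, hitL ν h = ν h • 1) :
    ∃ c : k, ν = c • l ∘ₗ antipode k := by
  let e := LinearEquiv.ofBijective _ (antipode_bijective hr hl1)
  let μ : H →ₗ[k] k := ν ∘ₗ e.symm.toLinearMap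
  have hμ : μ ∘ₗ antipode k = ν := by
    ext h
    change ν (e.symm (e h)) = ν h
    rw [e.symm_apply_apply]
  obtain ⟨c, hc⟩ := left_integral_unique hr hl1 (μ := μ) fun h => by
    obtain ⟨y, rfl⟩ := (antipode_bijective hr hl1).2 h
    rw [← antipode_hitL, hμ, hν, map_smul, antipode_one, ← hμ]
    rfl
  refine ⟨c, ?_⟩
  rw [← hμ, hc, LinearMap.smul_comp]

lemma eq_zero_of_forall_mul_dual_integral
    (hr : ∀ a : H, Λ * a = counit (R := k) a • Λ)
    (hl1 : hitR l Λ = 1) {h : H} (hh : ∀ a, l (a * h) = 0) : h = 0 := by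
  obtain ⟨y, rfl⟩ := (antipode_bijective hr hl1).2 h
  have h1 : l ∘ₗ LinearMap.mulRight k (antipode k y) = 0 := by ext a; simpa using hh a
  have h2 := hitR_mulRight_antipode_eq hr hl1 y
  rw [h1, ← hitRLinear_apply, map_zero, LinearMap.zero_apply] at h2
  rw [← h2, map_zero]

/-- The distinguished grouplike element of the dual integral. -/
lemma exists_distinguished_grouplike (hr : ∀ a : H, Λ * a = counit (R := k) a • Λ)
    (hl1 : hitR l Λ = 1) :
    ∃ g : H, IsGroupLikeElem k g ∧ ∀ h, hitL l h = l h • g := by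
  have hne : ∃ h0, l h0 = 1 := by
    by_contra! hcon
    have h0 : l = 0 := by
      ext h
      by_contra hh
      exact hcon ((l h)⁻¹ • h) (by simpa using inv_mul_cancel₀ hh)
    have h2 : (1 : H) = 0 := by
      rw [← hl1, h0, ← hitRLinear_apply, map_zero, LinearMap.zero_apply]
    have h3 := congrArg (counit (R := k)) h2
    simp at h3
  obtain ⟨h0, h01⟩ := hne
  have hg : ∀ h, hitL l h = l h • hitL l h0 := by
    intro h
    refine dual_ext (k := k) fun p => ?_
    obtain ⟨c, hc⟩ := left_integral_unique hr hl1 (μ := l ∘ₗ hitR p) fun h => by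
      refine dual_ext (k := k) fun q => ?_
      rw [dual_hitR, LinearMap.comp_apply, ← hitL_hitR, ← dual_hitR q l,
        hitR_dual_integral hr hl1]
      rfl
    have h1 := LinearMap.congr_fun hc h
    have h2 := LinearMap.congr_fun hc h0
    simp only [LinearMap.comp_apply, dual_hitR, LinearMap.smul_apply, h01, smul_eq_mul] at h1 h2
    rw [h1, map_smul, h2, smul_eq_mul]
    ring
  refine ⟨hitL l h0, ?_, hg⟩
  have hgL : ∀ p : H →ₗ[k] k, hitL p (hitL l h0) = p (hitL l h0) • hitL l h0 := by
    intro p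
    have h1 : p ∘ₗ hitL l = p (hitL l h0) • l := by
      ext h
      rw [LinearMap.comp_apply, hg, map_smul]
      simp [mul_comm]
    rw [hitL_hitL, h1, hitL_smul]
    rfl
  constructor
  · rw [← dual_hitR, hitR_counit, h01]
  · rw [comul_eq_sum_hitL (Module.finBasis k H)]
    simp_rw [hgL, ← TensorProduct.smul_tmul, ← TensorProduct.sum_tmul, Module.Basis.coord_apply]
    rw [Module.Basis.sum_repr]

lemma exists_dual_integral_mul_grouplike (hr : ∀ a : H, Λ * a = counit (R := k) a • Λ)
    (hl1 : hitR l Λ = 1) {g : H} (hg : IsGroupLikeElem k g) (hlg : ∀ h, hitL l h = l h • g) :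
    ∃ c : k, ∀ h, l (h * g) = c * l (antipode k h) := by
  have hu : IsUnit g := hg.isUnit
  obtain ⟨c, hc⟩ := right_integral_unique hr hl1 (ν := l ∘ₗ LinearMap.mulRight k g) fun h => by
    have h1 := hlg (h * g)
    have h2 : hitL l (h * g) = hitL (l ∘ₗ LinearMap.mulRight k g) h * g := by
      simp only [hitL, LinearMap.comp_apply]
      rw [Bialgebra.comul_mul, hg.comul_eq_tmul_self, ← (ℛ k h).eq]
      simp [Finset.sum_mul]
    refine hu.mul_right_cancel ?_
    rw [← h2, h1]
    simp
  exact ⟨c, LinearMap.congr_fun hc⟩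

end DualIntegral

section AntipodeSq

variable {k H : Type*} [Field k] [Ring H] [HopfAlgebra k H] {Λ : H} {l : H →ₗ[k] k}

variable (k H) in
/-- The square of the antipode, as an algebra endomorphism. -/
noncomputable def antipodeSq : H →ₐ[k] H :=
  AlgHom.ofLinearMap (antipode k ∘ₗ antipode k) (by simp)
    (fun a b => by simp [antipode_mul_antidistrib])

lemma antipodeSq_apply (h : H) : antipodeSq k H h = antipode k (antipode k h) := rfl

variable [FiniteDimensional k H]

lemma trace_mulLeft_comp_antipodeSq (hl : ∀ a : H, a * Λ = counit (R := k) a • Λ)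
    (hl1 : hitR l Λ = 1) (h : H) :
    LinearMap.trace k H (LinearMap.mulLeft k h ∘ₗ (antipodeSq k H).toLinearMap) =
      counit (R := k) Λ * l h := by
  have h1 : LinearMap.mulLeft k h ∘ₗ (antipodeSq k H).toLinearMap =
      ∑ i ∈ (ℛ k Λ).index, (l ∘ₗ LinearMap.mulRight k ((ℛ k Λ).right i)).smulRight
        (h * antipode k ((ℛ k Λ).left i)) := by
    ext x
    have h2 := hitR_mulLeft_eq hl hl1 x
    rw [hitR_apply] at h2
    simp only [LinearMap.comp_apply, AlgHom.toLinearMap_apply, antipodeSq_apply, ← h2]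
    simp
  rw [h1, map_sum]
  simp_rw [LinearMap.trace_smulRight, LinearMap.comp_apply, LinearMap.mulRight_apply, mul_assoc]
  rw [← map_sum, ← Finset.mul_sum, sum_antipode_mul_eq_algebraMap_counit,
    Algebra.algebraMap_eq_smul_one]
  simp

lemma dual_integral_mul_comm (hl : ∀ a : H, a * Λ = counit (R := k) a • Λ)
    (hε : counit (R := k) Λ ≠ 0) (hl1 : hitR l Λ = 1) (a b : H) :
    l (a * b) = l (b * antipodeSq k H a) := by
  refine mul_left_cancel₀ hε ?_
  rw [← trace_mulLeft_comp_antipodeSq hl hl1, ← trace_mulLeft_comp_antipodeSq hl hl1]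
  have h1 : LinearMap.mulLeft k (a * b) ∘ₗ (antipodeSq k H).toLinearMap =
    LinearMap.mulLeft k a * (LinearMap.mulLeft k b ∘ₗ (antipodeSq k H).toLinearMap) := by
    ext x
    simp
  rw [h1, LinearMap.trace_mul_comm]
  congr 1
  ext x
  simp

lemma isOfFinOrder_groupLike {g : H} (hg : IsGroupLikeElem k g) : ∃ m, 0 < m ∧ g ^ m = 1 := by
  have : Finite (GroupLike k H) := (linearIndep_groupLikeVal (R := k) (A := H)).finite
  obtain ⟨m, hm, h⟩ := (isOfFinOrder_of_finite (⟨g, hg⟩ : GroupLike k H)).exists_pow_eq_one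
  exact ⟨m, hm, congrArg GroupLike.val h⟩

/-- The fourth power of the antipode is conjugation by the distinguished grouplike. -/
lemma mul_grouplike_eq (hl : ∀ a : H, a * Λ = counit (R := k) a • Λ)
    (hr : ∀ a : H, Λ * a = counit (R := k) a • Λ)
    (hε : counit (R := k) Λ ≠ 0) (hl1 : hitR l Λ = 1) {g : H} (hg : IsGroupLikeElem k g)
    (hlg : ∀ h, hitL l h = l h • g) (b : H) :
    b * g = g * antipodeSq k H (antipodeSq k H b) := by
  obtain ⟨c, hc⟩ := exists_dual_integral_mul_grouplike hr hl1 hg hlg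
  rw [← sub_eq_zero]
  refine eq_zero_of_forall_mul_dual_integral hr hl1 fun a => ?_
  rw [mul_sub, map_sub, sub_eq_zero, ← mul_assoc, hc, antipode_mul_antidistrib,
    dual_integral_mul_comm hl hε hl1]
  have h1 : antipode k a * antipodeSq k H (antipode k b) =
      antipode k (antipodeSq k H b * a) := by
    rw [antipode_mul_antidistrib]; rfl
  rw [h1, ← hc, mul_assoc, dual_integral_mul_comm hl hε hl1, mul_assoc]

/-- The square of the antipode has finite order. -/
lemma exists_antipodeSq_pow_eq_id (hl : ∀ a : H, a * Λ = counit (R := k) a • Λ)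
    (hr : ∀ a : H, Λ * a = counit (R := k) a • Λ)
    (hε : counit (R := k) Λ ≠ 0) (hl1 : hitR l Λ = 1) :
    ∃ m, 0 < m ∧ ∀ h, (antipodeSq k H)^[m] h = h := by
  obtain ⟨g, hg, hlg⟩ := exists_distinguished_grouplike hr hl1
  obtain ⟨m, hm, hgm⟩ := isOfFinOrder_groupLike hg
  have hpow : ∀ j b, b * g ^ j = g ^ j * (antipodeSq k H)^[2 * j] b := by
    intro j
    induction j with
    | zero => simp
    | succ j ih =>
      intro b
      rw [pow_succ, ← mul_assoc, ih, mul_assoc, mul_grouplike_eq hl hr hε hl1 hg hlg,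
        mul_assoc, mul_add, add_comm (2 * j), Function.iterate_add_apply]
      rfl
  refine ⟨2 * m, by omega, fun h => ?_⟩
  have := hpow m h
  rwa [hgm, mul_one, one_mul, eq_comm] at this

end AntipodeSq

end HopfAlgebra

universe u v

section Nonneg

variable {k : Type*} [Field k] [CharZero k]

variable (k) in
/-- An embedding of the algebraic numbers of `k` into `ℂ`. -/
noncomputable def algebraicClosureToComplex : algebraicClosure ℚ k →ₐ[ℚ] ℂ :=
  have : Algebra.IsAlgebraic ℚ (algebraicClosure ℚ k) := by
    convert algebraicClosure.isAlgebraic ℚ k using 1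
    · rfl
    · exact Subsingleton.elim _ _
  IsAlgClosed.lift

open ComplexOrder in
/-- An element is algebraically nonnegative if it is an algebraic number whose image under the
chosen embedding into `ℂ` is a nonnegative real. -/
def IsAlgNonneg (x : k) : Prop :=
  ∃ q : algebraicClosure ℚ k, (q : k) = x ∧ 0 ≤ algebraicClosureToComplex k q

open ComplexOrder in
lemma sum_ne_zero_of_isAlgNonneg {ι : Type*} (s : Finset ι) {x : ι → k}
    (hx : ∀ i ∈ s, IsAlgNonneg (x i)) {i : ι} (hi : i ∈ s) (h0 : x i ≠ 0) :
    ∑ i ∈ s, x i ≠ 0 := by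
  classical
  have hx' : ∀ i : s, IsAlgNonneg (x i) := fun i => hx i i.2
  choose q hq hq0 using hx'
  rw [← Finset.sum_coe_sort]
  simp_rw [← hq]
  intro h
  have h1 : ∑ j : s, q j = 0 := by
    apply Subtype.ext
    push_cast
    exact h
  have h2 := congrArg (algebraicClosureToComplex k) h1
  rw [map_sum, map_zero, Finset.sum_eq_zero_iff_of_nonneg fun j _ => hq0 j] at h2
  have h3 := h2 ⟨i, hi⟩ (Finset.mem_univ _)
  rw [map_eq_zero] at h3
  exact h0 (by rw [← hq ⟨i, hi⟩, h3]; rfl)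

lemma isAlgNonneg_sum_mul_sum_inv {ι : Type*} [Fintype ι] {N : ℕ} (hN : 0 < N) {ζ : ι → k}
    (hζ : ∀ i, ζ i ^ N = 1) : IsAlgNonneg ((∑ i, ζ i) * ∑ i, (ζ i)⁻¹) := by
  have hmem : ∀ i, ζ i ∈ algebraicClosure ℚ k := fun i => by
    rw [mem_algebraicClosure_iff]
    exact ⟨Polynomial.X ^ N - 1, Polynomial.X_pow_sub_C_ne_zero hN 1, by simp [hζ]⟩
  let q : ι → algebraicClosure ℚ k := fun i => ⟨ζ i, hmem i⟩
  refine ⟨(∑ i, q i) * ∑ i, (q i)⁻¹, by push_cast; rfl, ?_⟩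
  have h1 : ∀ i, ‖algebraicClosureToComplex k (q i)‖ = 1 := fun i => by
    have h2 : q i ^ N = 1 := Subtype.ext (by simpa [q] using hζ i)
    refine Complex.norm_eq_one_of_pow_eq_one (n := N) ?_ hN.ne'
    rw [← map_pow, h2, map_one]
  have h3 : ∑ i, (algebraicClosureToComplex k (q i))⁻¹ =
      (starRingEnd ℂ) (∑ i, algebraicClosureToComplex k (q i)) := by
    rw [map_sum]
    exact Finset.sum_congr rfl fun i _ => Complex.inv_eq_conj (h1 i)
  rw [map_mul, map_sum, map_sum]
  simp_rw [map_inv₀]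
  rw [h3, Complex.mul_conj]
  exact_mod_cast Complex.normSq_nonneg _

end Nonneg

section FiniteOrder

variable {k : Type u} {V : Type v} [Field k] [AddCommGroup V] [Module k V]

lemma trace_eq_sum_of_basis_eigenvectors {ι : Type*} [Fintype ι] (b : Module.Basis ι k V)
    {f : Module.End k V} {ζ : ι → k} (h : ∀ i, f (b i) = ζ i • b i) :
    LinearMap.trace k V f = ∑ i, ζ i := by
  classical
  rw [LinearMap.trace_eq_matrix_trace k b, Matrix.trace]
  simp [LinearMap.toMatrix_apply, h]

variable [IsAlgClosed k] [CharZero k]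

lemma exists_basis_eigenvectors_of_pow_eq_one [FiniteDimensional k V]
    {f : Module.End k V} {N : ℕ} (hN : 0 < N)
    (hf : f ^ N = 1) :
    ∃ (ι : Type u) (_ : Fintype ι) (b : Module.Basis ι k V) (ζ : ι → k),
      ∀ i, f (b i) = ζ i • b i := by
  classical
  have hs : f.IsFinitelySemisimple := by
    refine Module.End.IsSemisimple.isFinitelySemisimple
      (Module.End.isSemisimple_of_squarefree_aeval_eq_zero (p := Polynomial.X ^ N - 1) ?_
        (by simp [hf]))
    refine Polynomial.Separable.squarefree ?_
    exact (Polynomial.X_pow_sub_one_separable_iff).2 (by exact_mod_cast hN.ne')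
  have hint := DirectSum.isInternal_submodule_of_iSupIndep_of_iSup_eq_top
    (Module.End.eigenspaces_iSupIndep f)
    (hs.iSup_maxGenEigenspace_eq_top_iff.1 (Module.End.iSup_maxGenEigenspace_eq_top f))
  let b := hint.collectedBasis fun μ => Module.finBasis k (f.eigenspace μ)
  refine ⟨_, FiniteDimensional.fintypeBasisIndex b, b, Sigma.fst, fun i => ?_⟩
  exact Module.End.mem_eigenspace_iff.1 (hint.collectedBasis_mem _ i)

lemma isAlgNonneg_trace_mul_trace [FiniteDimensional k V]
    {f f' : Module.End k V} {N : ℕ} (hN : 0 < N)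
    (hf : f ^ N = 1) (hff' : f' * f = 1) :
    IsAlgNonneg (LinearMap.trace k V f * LinearMap.trace k V f') := by
  obtain ⟨ι, _, b, ζ, hb⟩ := exists_basis_eigenvectors_of_pow_eq_one hN hf
  have hpow : ∀ j i, (f ^ j) (b i) = ζ i ^ j • b i := by
    intro j i
    induction j with
    | zero => simp
    | succ j ih => rw [pow_succ, Module.End.mul_apply, hb, map_smul, ih, smul_smul, pow_succ']
  have hζ : ∀ i, ζ i ^ N = 1 := fun i => by
    have h1 := hpow N i
    rw [hf, Module.End.one_apply] at h1
    exact (smul_left_injective k (b.ne_zero i) (by simpa using h1)).symm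
  have hb' : ∀ i, f' (b i) = (ζ i)⁻¹ • b i := fun i => by
    have h0 : ζ i ≠ 0 := fun h => by
      have := hζ i
      rw [h, zero_pow hN.ne'] at this
      exact zero_ne_one this
    have h1 := LinearMap.congr_fun hff' (b i)
    rw [Module.End.mul_apply, hb, map_smul, Module.End.one_apply] at h1
    rw [eq_inv_smul_iff₀ h0, h1]
  rw [trace_eq_sum_of_basis_eigenvectors b hb, trace_eq_sum_of_basis_eigenvectors b hb']
  exact isAlgNonneg_sum_mul_sum_inv hN hζ

lemma Matrix.isAlgNonneg_trace_mul_trace {n : Type*} [Fintype n] [DecidableEq n]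
    {w w' : Matrix n n k} {N : ℕ} (hN : 0 < N) {c : k} (hc : w ^ N = c • 1) (hww' : w' * w = 1) :
    IsAlgNonneg (w.trace * w'.trace) := by
  obtain _ | _ := isEmpty_or_nonempty n
  · exact ⟨0, by simp [Matrix.trace], by simp⟩
  have hc0 : c ≠ 0 := by
    rintro rfl
    have h1 : w' ^ N * w ^ N = 1 := by
      have hcomm : Commute w' w := (hww'.trans (mul_eq_one_comm.1 hww').symm)
      rw [← hcomm.mul_pow, hww', one_pow]
    rw [hc, zero_smul, mul_zero] at h1
    exact zero_ne_one h1
  obtain ⟨r, hr⟩ := IsAlgClosed.exists_pow_nat_eq c hN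
  have hr0 : r ≠ 0 := by
    rintro rfl
    exact hc0 (by rw [← hr, zero_pow hN.ne'])
  have h := _root_.isAlgNonneg_trace_mul_trace (f := Matrix.toLinAlgEquiv' (r⁻¹ • w))
    (f' := Matrix.toLinAlgEquiv' (r • w')) hN
    (by rw [← map_pow, smul_pow, hc, ← hr, smul_smul, inv_pow, inv_mul_cancel₀ (pow_ne_zero _ hr0),
      one_smul, map_one])
    (by rw [← map_mul, smul_mul_smul_comm, mul_inv_cancel₀ hr0, one_smul, hww', map_one])
  have ht : ∀ A : Matrix n n k, LinearMap.trace k _ (Matrix.toLinAlgEquiv' A) = A.trace :=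
    fun A => Matrix.trace_toLin'_eq A
  rw [ht, ht, Matrix.trace_smul, Matrix.trace_smul, smul_mul_smul_comm, inv_mul_cancel₀ hr0,
    one_smul] at h
  exact h

end FiniteOrder

section Semisimple

variable {k : Type*} [Field k]

lemma Matrix.eq_smul_one_of_forall_commute {n : Type*} [Fintype n] [DecidableEq n]
    {A : Matrix n n k} (h : ∀ B, Commute A B) : ∃ c : k, A = c • 1 := by
  obtain ⟨c, rfl⟩ := Matrix.mem_range_scalar_of_commute_single (M := A) fun i j _ => (h _).symm
  exact ⟨c, by rw [Matrix.smul_one_eq_diagonal, Matrix.scalar_apply]⟩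

lemma trace_mulLeft_mulRight_pi_matrix {n : ℕ} {d : Fin n → ℕ}
    (w w' : Π i, Matrix (Fin (d i)) (Fin (d i)) k) :
    LinearMap.trace k _ (LinearMap.mulLeft k w ∘ₗ LinearMap.mulRight k w') =
      ∑ i, (w i).trace * (w' i).trace := by
  let b := Pi.basis fun i => Matrix.stdBasis k (Fin (d i)) (Fin (d i))
  rw [LinearMap.trace_eq_matrix_trace k b, Matrix.trace, Fintype.sum_sigma]
  refine Finset.sum_congr rfl fun i _ => ?_
  rw [Fintype.sum_prod_type, Matrix.trace, Matrix.trace, Finset.sum_mul_sum]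
  refine Finset.sum_congr rfl fun a _ => Finset.sum_congr rfl fun c _ => ?_
  simp only [Matrix.diag_apply, LinearMap.toMatrix_apply, b, Pi.basis_repr, Pi.basis_apply,
    LinearMap.comp_apply, LinearMap.mulLeft_apply, LinearMap.mulRight_apply, Pi.mul_apply,
    Pi.single_eq_same, Matrix.stdBasis_eq_single]
  change (w i * (Matrix.single a c 1 * w' i) : Matrix (Fin (d i)) (Fin (d i)) k) a c = _
  simp [Matrix.mul_apply, Matrix.single_apply, ite_and]

variable [IsAlgClosed k] [CharZero k]

/-- The trace of an inner automorphism of finite order of a semisimple algebra is nonzero when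
the implementing unit acts by a scalar on some nonzero central element. -/
lemma trace_mulLeft_mulRight_ne_zero {R : Type*} [Ring R] [Algebra k R] [FiniteDimensional k R]
    [IsSemisimpleRing R] {w w' z : R} (hw : w' * w = 1) {N : ℕ} (hN : 0 < N)
    (hwN : ∀ a, Commute (w ^ N) a) (hz0 : z ≠ 0) (hz : ∀ a, Commute z a) {c : k}
    (hzw : z * w = c • z) :
    LinearMap.trace k R (LinearMap.mulLeft k w ∘ₗ LinearMap.mulRight k w') ≠ 0 := by
  obtain ⟨n, d, hd, ⟨e⟩⟩ := IsSemisimpleRing.exists_algEquiv_pi_matrix_of_isAlgClosed k R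
  have h1 : LinearMap.mulLeft k (e w) ∘ₗ LinearMap.mulRight k (e w') =
      e.toLinearEquiv.conj (LinearMap.mulLeft k w ∘ₗ LinearMap.mulRight k w') := by
    refine LinearMap.ext fun x => ?_
    simp [LinearEquiv.conj_apply]
  have hcen : ∀ {y : R}, (∀ a, Commute y a) → ∀ i, ∃ c : k, e y i = c • 1 := by
    intro y hy i
    refine Matrix.eq_smul_one_of_forall_commute fun B => ?_
    have h2 := (hy (e.symm (Pi.single i B))).map e
    have h3 := congrFun h2 i
    simpa [Commute, SemiconjBy] using h3
  have hinv : ∀ i, e w' i * e w i = 1 := fun i => by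
    have := congrFun (congrArg e hw) i
    simpa using this
  rw [← LinearMap.trace_conj' _ e.toLinearEquiv, ← h1, trace_mulLeft_mulRight_pi_matrix]
  obtain ⟨i, hi⟩ : ∃ i, e z i ≠ 0 := by
    by_contra! hcon
    exact hz0 (e.injective (by rw [map_zero]; exact funext hcon))
  obtain ⟨s, hs⟩ := hcen hz i
  have hs0 : s ≠ 0 := by
    rintro rfl
    exact hi (by rw [hs, zero_smul])
  have hwi : e w i = c • 1 := by
    have h2 := congrFun (congrArg e hzw) i
    rw [map_mul, Pi.mul_apply, map_smul, Pi.smul_apply, hs, smul_mul_assoc, one_mul,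
      smul_comm] at h2
    exact smul_right_injective _ hs0 h2
  have hc0 : c ≠ 0 := by
    rintro rfl
    have h2 := hinv i
    rw [hwi, zero_smul, mul_zero] at h2
    exact zero_ne_one h2
  have hwi' : e w' i = c⁻¹ • 1 := by
    have h2 := hinv i
    rw [hwi, mul_smul_comm, mul_one] at h2
    rw [eq_inv_smul_iff₀ hc0, h2]
  refine sum_ne_zero_of_isAlgNonneg _ (fun j _ => ?_) (Finset.mem_univ i) ?_
  · obtain ⟨cj, hcj⟩ := hcen hwN j
    refine Matrix.isAlgNonneg_trace_mul_trace hN (c := cj) ?_ (hinv j)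
    rw [← hcj, map_pow, Pi.pow_apply]
  · rw [hwi, hwi', Matrix.trace_smul, Matrix.trace_smul]
    have : (d i : k) ≠ 0 := by exact_mod_cast NeZero.ne (d i)
    simp [hc0, this]

end Semisimple

lemma trace_mulLeft_comm {k R : Type*} [Field k] [Ring R] [Algebra k R] (a b : R) :
    LinearMap.trace k R (LinearMap.mulLeft k (a * b)) =
      LinearMap.trace k R (LinearMap.mulLeft k (b * a)) := by
  rw [LinearMap.mulLeft_mul, LinearMap.mulLeft_mul, ← Module.End.mul_eq_comp,
    LinearMap.trace_mul_comm, Module.End.mul_eq_comp]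

lemma eq_zero_of_forall_trace_mulLeft_eq_zero {k R : Type*} [Field k] [CharZero k] [Ring R]
    [Algebra k R] [FiniteDimensional k R] [IsSemisimpleRing R] {a : R}
    (h : ∀ b, LinearMap.trace k R (LinearMap.mulLeft k (a * b)) = 0) : a = 0 := by
  obtain ⟨e, he, hI⟩ := IsSemisimpleRing.ideal_eq_span_idempotent (Ideal.span {a})
  have he1 : e ∈ Ideal.span {a} := hI ▸ Ideal.mem_span_singleton_self e
  have ha1 : a ∈ Ideal.span {e} := hI ▸ Ideal.mem_span_singleton_self a
  obtain ⟨b, hb⟩ := Ideal.mem_span_singleton'.1 he1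
  obtain ⟨c, hc⟩ := Ideal.mem_span_singleton'.1 ha1
  have hid : IsIdempotentElem (LinearMap.mulLeft k e) := by
    rw [IsIdempotentElem, Module.End.mul_eq_comp, ← LinearMap.mulLeft_mul, he.eq]
  have htr : LinearMap.trace k R (LinearMap.mulLeft k e) = 0 := by
    rw [← hb, trace_mulLeft_comm, h]
  have h0 := LinearMap.congr_fun (LinearMap.IsIdempotentElem.eq_zero_of_trace_eq_zero hid htr) 1
  rw [← hc]
  simpa using congrArg (c * ·) h0

namespace HopfAlgebra

section Semisimple

variable {k H : Type*} [Field k] [CharZero k] [Ring H] [HopfAlgebra k H]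
  [FiniteDimensional k H] [IsSemisimpleRing H] {Λ : H} {l : H →ₗ[k] k}

/-- The square of the antipode of a semisimple Hopf algebra is inner. -/
lemma exists_antipodeSq_inner (hl : ∀ a : H, a * Λ = counit (R := k) a • Λ)
    (hr : ∀ a : H, Λ * a = counit (R := k) a • Λ)
    (hε : counit (R := k) Λ ≠ 0) (hl1 : hitR l Λ = 1) :
    ∃ w w' : H, w * w' = 1 ∧ w' * w = 1 ∧ ∀ a, w * a = antipodeSq k H a * w := by
  let F : H →ₗ[k] (H →ₗ[k] k) :=
    LinearMap.compr₂ (LinearMap.mul k H) (LinearMap.trace k H ∘ₗ (LinearMap.mul k H))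
  have hF : ∀ a b, F a b = LinearMap.trace k H (LinearMap.mulLeft k (a * b)) := fun _ _ => rfl
  have hinj : Function.Injective F := by
    rw [← LinearMap.ker_eq_bot, LinearMap.ker_eq_bot']
    intro a ha
    exact eq_zero_of_forall_trace_mulLeft_eq_zero (k := k) fun b => by rw [← hF, ha]; rfl
  have hcomm : ∀ a b c, F a (b * c) = F (c * a) b := fun a b c => by
    rw [hF, hF, ← mul_assoc, trace_mulLeft_comm, mul_assoc]
  obtain ⟨w, hw⟩ := (LinearMap.injective_iff_surjective_of_finrank_eq_finrank
      (Subspace.dual_finrank_eq (K := k) (V := H)).symm).1 hinj l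
  have hwl : ∀ a b, l (a * b) = F (w * a) b := fun a b => by
    rw [← hw, hF, hF, mul_assoc]
  have hwinj : Function.Injective (LinearMap.mulLeft k w) := by
    rw [← LinearMap.ker_eq_bot, LinearMap.ker_eq_bot']
    intro b hb
    rw [LinearMap.mulLeft_apply] at hb
    refine eq_zero_of_forall_dual_integral_mul hl hr hl1 fun a => ?_
    rw [hwl, hb, map_zero, LinearMap.zero_apply]
  obtain ⟨w', hw'⟩ := LinearMap.surjective_of_injective hwinj 1
  rw [LinearMap.mulLeft_apply] at hw'
  refine ⟨w, w', hw', hwinj ?_, fun a => hinj ?_⟩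
  · rw [LinearMap.mulLeft_apply, LinearMap.mulLeft_apply, ← mul_assoc, hw', one_mul, mul_one]
  · ext b
    rw [← hwl, dual_integral_mul_comm hl hε hl1, ← hcomm, ← hw]

variable [IsAlgClosed k]

lemma trace_antipodeSq_ne_zero (hl : ∀ a : H, a * Λ = counit (R := k) a • Λ)
    (hr : ∀ a : H, Λ * a = counit (R := k) a • Λ)
    (hε : counit (R := k) Λ ≠ 0) (hl1 : hitR l Λ = 1) :
    LinearMap.trace k H (antipodeSq k H).toLinearMap ≠ 0 := by
  obtain ⟨w, w', hww', hw'w, hw⟩ := exists_antipodeSq_inner hl hr hε hl1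
  obtain ⟨m, hm, hmT⟩ := exists_antipodeSq_pow_eq_id hl hr hε hl1
  have hT : (antipodeSq k H).toLinearMap = LinearMap.mulLeft k w ∘ₗ LinearMap.mulRight k w' := by
    ext a
    simp only [AlgHom.toLinearMap_apply, LinearMap.comp_apply, LinearMap.mulLeft_apply,
      LinearMap.mulRight_apply]
    rw [← mul_assoc, hw, mul_assoc, hww', mul_one]
  have hpow : ∀ j a, w ^ j * a = (antipodeSq k H)^[j] a * w ^ j := by
    intro j
    induction j with
    | zero => simp
    | succ j ih =>
      intro a
      rw [pow_succ, mul_assoc, hw, ← mul_assoc, ih, mul_assoc, Function.iterate_succ_apply]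
  rw [hT]
  refine trace_mulLeft_mulRight_ne_zero hw'w hm (fun a => ?_) (z := Λ) ?_ (fun a => ?_) (hr w)
  · rw [Commute, SemiconjBy, hpow, hmT]
  · rintro rfl
    exact hε (map_zero _)
  · rw [Commute, SemiconjBy, hl, hr]

lemma dual_integral_one_ne_zero (hl : ∀ a : H, a * Λ = counit (R := k) a • Λ)
    (hr : ∀ a : H, Λ * a = counit (R := k) a • Λ)
    (hε : counit (R := k) Λ ≠ 0) (hl1 : hitR l Λ = 1) : l 1 ≠ 0 := by
  intro h
  refine trace_antipodeSq_ne_zero hl hr hε hl1 ?_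
  have h1 := trace_mulLeft_comp_antipodeSq hl hl1 1
  rw [h, mul_zero, LinearMap.mulLeft_one] at h1
  exact h1

/-- The fourth power of the antipode is the identity. -/
lemma antipodeSq_antipodeSq (hl : ∀ a : H, a * Λ = counit (R := k) a • Λ)
    (hr : ∀ a : H, Λ * a = counit (R := k) a • Λ)
    (hε : counit (R := k) Λ ≠ 0) (hl1 : hitR l Λ = 1) (h : H) :
    antipodeSq k H (antipodeSq k H h) = h := by
  obtain ⟨g, hg, hlg⟩ := exists_distinguished_grouplike hr hl1
  have hg1 : g = 1 := by
    have h1 := hlg 1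
    rw [hitL_one] at h1
    exact (smul_right_injective H (dual_integral_one_ne_zero hl hr hε hl1) h1).symm
  have h2 := mul_grouplike_eq hl hr hε hl1 hg hlg h
  rw [hg1, mul_one, one_mul] at h2
  exact h2.symm

end Semisimple

local infixl:70 "⋆" => conv

section TraceElement

variable {k H : Type*} [Field k] [Ring H] [HopfAlgebra k H]

variable (k H) in
/-- The twisted Galois map `h ⊗ y ↦ y₍₂₎ h ⊗ y₍₁₎`. -/
noncomputable def galoisMap : H ⊗[k] H →ₗ[k] H ⊗[k] H :=
  LinearMap.mul' k (H ⊗[k] H) ∘ₗ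
    TensorProduct.map ((TensorProduct.comm k H H).toLinearMap ∘ₗ comul) (inclL k H).toLinearMap ∘ₗ
      (TensorProduct.comm k H H).toLinearMap

lemma galoisMap_tmul (h y : H) : galoisMap k H (h ⊗ₜ y) =
    TensorProduct.comm k H H (comul y) * (h ⊗ₜ[k] 1) := by
  simp [galoisMap]

lemma galoisMap_surjective : Function.Surjective (galoisMap k H) := by
  rw [← LinearMap.range_eq_top, eq_top_iff, ← TensorProduct.span_tmul_eq_top, Submodule.span_le]
  rintro _ ⟨u, v, rfl⟩
  have h1 : ((TensorProduct.comm k H H).toLinearMap ∘ₗ comul) ⋆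
      ((inclL k H).toLinearMap ∘ₗ antipode k) = (inclR k H).toLinearMap := by
    rw [comm_comul_eq_conv, conv_assoc, conv_antipode, conv_counit]
  refine ⟨∑ i ∈ (ℛ k v).index, (antipode k ((ℛ k v).right i) * u) ⊗ₜ (ℛ k v).left i, ?_⟩
  have h2 := congrArg (· * (u ⊗ₜ[k] (1 : H))) (LinearMap.congr_fun h1 v)
  rw [conv_apply] at h2
  simp only [map_sum, galoisMap_tmul]
  simpa [Finset.sum_mul, mul_assoc] using h2

lemma hitR_mul {ι : Type*} [Fintype ι] (b : Module.Basis ι k H) (p : H →ₗ[k] k) (y h : H) :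
    hitR p (y * h) =
      ∑ j, hitR (p ∘ₗ LinearMap.mulRight k (b j)) y * hitR (b.coord j) h := by
  conv_lhs => rw [hitR, LinearMap.comp_apply, LinearMap.comp_apply, Bialgebra.comul_mul,
    comul_eq_sum_hitR b h, ← (ℛ k y).eq]
  simp only [hitR_apply _ y, Finset.mul_sum, Finset.sum_mul, map_sum]
  refine Finset.sum_congr rfl fun j _ => Finset.sum_congr rfl fun i _ => ?_
  simp

variable [FiniteDimensional k H]

variable (k H) in
lemma exists_trace_element : ∃ x : H, ∀ p : H →ₗ[k] k, p x = LinearMap.trace k H (hitR p) := by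
  refine ⟨(Module.evalEquiv k H).symm (LinearMap.trace k H ∘ₗ hitRLinear k H), fun p => ?_⟩
  rw [Module.apply_evalEquiv_symm_apply]
  rfl

lemma trace_element_mul_self {x : H}
    (hx : ∀ p : H →ₗ[k] k, p x = LinearMap.trace k H (hitR p)) :
    x * x = (Module.finrank k H : k) • x := by
  refine dual_ext (k := k) fun p => ?_
  let b := Module.finBasis k H
  let A : H ⊗[k] H →ₗ[k] H ⊗[k] H :=
    ∑ j, TensorProduct.map (hitR (b.coord j)) (hitR (p ∘ₗ LinearMap.mulRight k (b j)))
  have hA : LinearMap.trace k _ A = p (x * x) := by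
    simp only [A, map_sum, LinearMap.trace_tensorProduct', ← hx, LinearMap.comp_apply,
      LinearMap.mulRight_apply]
    conv_rhs => rw [← b.sum_repr x, Finset.mul_sum, map_sum]
    refine Finset.sum_congr rfl fun j _ => ?_
    rw [b.sum_repr x]
    simp
  let e := LinearEquiv.ofBijective (galoisMap k H)
    ⟨LinearMap.injective_iff_surjective.2 galoisMap_surjective, galoisMap_surjective⟩
  have hinter : galoisMap k H ∘ₗ A = (hitR p).rTensor H ∘ₗ galoisMap k H := by
    refine TensorProduct.ext' fun h y => ?_
    have h1 : ∀ q : H →ₗ[k] k, TensorProduct.comm k H H (comul (hitR q y)) =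
        ∑ i ∈ (ℛ k y).index, hitR q ((ℛ k y).right i) ⊗ₜ (ℛ k y).left i := fun q => by
      have h2 := LinearMap.congr_fun
        (comp_hitR ((inclR k H).toLinearMap ⋆ (inclL k H).toLinearMap) q) y
      rw [conv_assoc, ← comp_hitR, ← comm_comul_eq_conv, conv_apply] at h2
      simpa using h2
    have h3 : TensorProduct.comm k H H (comul y) =
        ∑ i ∈ (ℛ k y).index, (ℛ k y).right i ⊗ₜ (ℛ k y).left i := by
      conv_lhs => rw [← (ℛ k y).eq]
      simp
    simp only [LinearMap.comp_apply, A, LinearMap.sum_apply, TensorProduct.map_tmul, map_sum,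
      galoisMap_tmul, h1, h3, Finset.sum_mul, Algebra.TensorProduct.tmul_mul_tmul, mul_one,
      LinearMap.rTensor_tmul, hitR_mul b, TensorProduct.sum_tmul]
    exact Finset.sum_comm
  have hconj : (hitR p).rTensor H = e.conj A := by
    refine LinearMap.ext fun t => ?_
    obtain ⟨s, rfl⟩ := e.surjective t
    rw [LinearEquiv.conj_apply_apply, e.symm_apply_apply]
    exact (LinearMap.congr_fun hinter s).symm
  rw [← hA, ← LinearMap.trace_conj' A e, ← hconj, LinearMap.rTensor,
    LinearMap.trace_tensorProduct', ← hx, LinearMap.trace_id, map_smul, smul_eq_mul, mul_comm]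

end TraceElement

end HopfAlgebra

section Involution

variable {k V : Type*} [Field k] [AddCommGroup V] [Module k V] [FiniteDimensional k V]

lemma exists_nat_trace_eq_of_isIdempotentElem {e : Module.End k V} (he : IsIdempotentElem e) :
    ∃ n : ℕ, LinearMap.trace k V e = n :=
  ⟨_, (LinearMap.IsIdempotentElem.isProj_range e he).trace⟩

variable [CharZero k]

/-- An involution whose trace is a nonzero integral multiple of the dimension is `± 1`. -/
lemma eq_one_or_eq_neg_one_of_trace_eq {f e : Module.End k V} (hf : f * f = 1)
    (he : IsIdempotentElem e) (hfe : Commute f e) (h0 : LinearMap.trace k V f ≠ 0)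
    (h : LinearMap.trace k V f = Module.finrank k V * LinearMap.trace k V (e * f)) :
    f = 1 ∨ f = -1 := by
  have h2 : (2 : k) ≠ 0 := two_ne_zero
  let P : Module.End k V := (2 : k)⁻¹ • (1 + f)
  let Q : Module.End k V := (2 : k)⁻¹ • (1 - f)
  have hP : IsIdempotentElem P := by
    have h3 : (1 + f) * (1 + f) = (2 : k) • (1 + f) := by
      rw [two_smul, mul_add, add_mul, add_mul, hf]; simp; abel
    rw [IsIdempotentElem, smul_mul_smul_comm, h3, smul_smul, mul_assoc, inv_mul_cancel₀ h2, mul_one]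
  have hQ : IsIdempotentElem Q := by
    have h3 : (1 - f) * (1 - f) = (2 : k) • (1 - f) := by
      rw [two_smul, mul_sub, sub_mul, sub_mul, hf]; simp; abel
    rw [IsIdempotentElem, smul_mul_smul_comm, h3, smul_smul, mul_assoc, inv_mul_cancel₀ h2, mul_one]
  have hPQ : P - Q = f := by
    rw [← smul_sub, add_sub_sub_cancel, ← two_smul k f, smul_smul, inv_mul_cancel₀ h2, one_smul]
  have hPQ' : P + Q = 1 := by
    rw [← smul_add, add_add_sub_cancel, ← two_smul k (1 : Module.End k V), smul_smul,
      inv_mul_cancel₀ h2, one_smul]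
  have heP : Commute e P := ((Commute.one_right e).add_right hfe.symm).smul_right _
  have heQ : Commute e Q := ((Commute.one_right e).sub_right hfe.symm).smul_right _
  obtain ⟨a, ha⟩ := exists_nat_trace_eq_of_isIdempotentElem hP
  obtain ⟨b, hb⟩ := exists_nat_trace_eq_of_isIdempotentElem hQ
  obtain ⟨c, hc⟩ := exists_nat_trace_eq_of_isIdempotentElem (he.mul_of_commute heP hP)
  obtain ⟨d, hd⟩ := exists_nat_trace_eq_of_isIdempotentElem (he.mul_of_commute heQ hQ)
  have h4 : LinearMap.trace k V f = a - b := by rw [← hPQ, map_sub, ha, hb]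
  have h5 : (Module.finrank k V : k) = a + b := by
    rw [← LinearMap.trace_one, ← hPQ', map_add, ha, hb]
  have h6 : LinearMap.trace k V (e * f) = c - d := by rw [← hPQ, mul_sub, map_sub, hc, hd]
  rw [h4, h5, h6] at h
  rw [h4] at h0
  have h7 : (a : ℤ) - b = (a + b) * (c - d) := by exact_mod_cast h
  have h8 : (a : ℤ) - b ≠ 0 := by exact_mod_cast h0
  have h9 : a = 0 ∨ b = 0 := by
    have h10 : (c : ℤ) - d ≠ 0 := by
      intro h10
      rw [h10, mul_zero] at h7
      exact h8 h7
    have h11 : (1 : ℤ) ≤ |(c : ℤ) - d| := Int.one_le_abs h10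
    have h12 : |(a : ℤ) - b| = (a + b) * |(c : ℤ) - d| := by
      rw [h7, abs_mul, abs_of_nonneg (by positivity : (0 : ℤ) ≤ a + b)]
    have h13 : (a : ℤ) + b ≤ |(a : ℤ) - b| := by
      rw [h12]
      nlinarith [Int.natCast_nonneg a, Int.natCast_nonneg b]
    rcases abs_cases ((a : ℤ) - b) with h14 | h14 <;> omega
  rcases h9 with rfl | rfl
  · right
    rw [LinearMap.IsIdempotentElem.eq_zero_of_trace_eq_zero hP (by simpa using ha), zero_add]
      at hPQ'
    rw [← hPQ, hPQ', LinearMap.IsIdempotentElem.eq_zero_of_trace_eq_zero hP (by simpa using ha),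
      zero_sub]
  · left
    rw [LinearMap.IsIdempotentElem.eq_zero_of_trace_eq_zero hQ (by simpa using hb), add_zero]
      at hPQ'
    rw [← hPQ, hPQ', LinearMap.IsIdempotentElem.eq_zero_of_trace_eq_zero hQ (by simpa using hb),
      sub_zero]

end Involution

namespace HopfAlgebra

variable {k H : Type*} [Field k] [Ring H] [HopfAlgebra k H] {Λ : H}

lemma antipodeSq_trace_element {x : H}
    (hx : ∀ p : H →ₗ[k] k, p x = LinearMap.trace k H (hitR p))
    (hinv : ∀ h, antipodeSq k H (antipodeSq k H h) = h) : antipodeSq k H x = x := by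
  refine dual_ext (k := k) fun p => ?_
  have hinv' : (antipodeSq k H).toLinearMap * (antipodeSq k H).toLinearMap = 1 :=
    LinearMap.ext hinv
  have h1 : (antipodeSq k H).toLinearMap * hitR (p ∘ₗ (antipodeSq k H).toLinearMap) =
      hitR p * (antipodeSq k H).toLinearMap := by
    refine LinearMap.ext fun h => ?_
    have h2 := antipode_hitR (p ∘ₗ antipode k) h
    have h3 := antipode_hitL p (antipode k h)
    rw [← h2] at h3
    exact h3
  have h4 : hitR (p ∘ₗ (antipodeSq k H).toLinearMap) =
      (antipodeSq k H).toLinearMap * (hitR p * (antipodeSq k H).toLinearMap) := by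
    rw [← h1, ← mul_assoc, hinv', one_mul]
  have h5 := hx (p ∘ₗ (antipodeSq k H).toLinearMap)
  rw [h4, LinearMap.trace_mul_comm, mul_assoc, hinv', mul_one, ← hx] at h5
  exact h5

/-- The **Larson–Radford theorem**: the antipode of a semisimple Hopf algebra over an
algebraically closed field of characteristic zero is an involution. -/
theorem antipode_antipode_of_isSemisimpleRing [CharZero k] [FiniteDimensional k H]
    [IsSemisimpleRing H] [IsAlgClosed k]
    (hl : ∀ a : H, a * Λ = counit (R := k) a • Λ)
    (hr : ∀ a : H, Λ * a = counit (R := k) a • Λ)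
    (hε : counit (R := k) Λ ≠ 0) (h : H) : antipode k (antipode k h) = h := by
  obtain ⟨l, hl1⟩ := exists_hitR_eq_one hr hε
  obtain ⟨x, hx⟩ := exists_trace_element k H
  have hinv := antipodeSq_antipodeSq hl hr hε hl1
  have hTx := antipodeSq_trace_element hx hinv
  have hxx := trace_element_mul_self hx
  have hnontriv : Nontrivial H := by
    refine nontrivial_of_ne Λ 0 ?_
    rintro rfl
    exact hε (map_zero _)
  have hn : (Module.finrank k H : k) ≠ 0 := by exact_mod_cast Module.finrank_pos.ne'
  have hlx : l x = l 1 := by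
    have h1 : hitR l = l.smulRight 1 := LinearMap.ext fun h => hitR_dual_integral hr hl1 h
    rw [hx, h1, LinearMap.trace_smulRight]
  have hff : (antipodeSq k H).toLinearMap * (antipodeSq k H).toLinearMap = 1 :=
    LinearMap.ext hinv
  let e : Module.End k H := (Module.finrank k H : k)⁻¹ • LinearMap.mulLeft k x
  have he : IsIdempotentElem e := by
    refine LinearMap.ext fun y => ?_
    simp only [e, Module.End.mul_apply, LinearMap.smul_apply, LinearMap.mulLeft_apply,
      mul_smul_comm, ← mul_assoc, hxx, smul_mul_assoc]
    rw [inv_smul_smul₀ hn]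
  have hfe : Commute (antipodeSq k H).toLinearMap e := by
    refine LinearMap.ext fun y => ?_
    simp [e, hTx]
  have htr : LinearMap.trace k H (antipodeSq k H).toLinearMap =
      Module.finrank k H * LinearMap.trace k H (e * (antipodeSq k H).toLinearMap) := by
    rw [smul_mul_assoc, map_smul, smul_eq_mul, mul_inv_cancel_left₀ hn,
      Module.End.mul_eq_comp, trace_mulLeft_comp_antipodeSq hl hl1, hlx,
      ← trace_mulLeft_comp_antipodeSq hl hl1, LinearMap.mulLeft_one, LinearMap.id_comp]
  rcases eq_one_or_eq_neg_one_of_trace_eq hff he hfe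
    (trace_antipodeSq_ne_zero hl hr hε hl1) htr with h1 | h1
  · exact LinearMap.congr_fun h1 h
  · have h2 := LinearMap.congr_fun h1 (1 : H)
    rw [AlgHom.toLinearMap_apply, map_one, LinearMap.neg_apply, Module.End.one_apply] at h2
    have h3 := congrArg (counit (R := k)) h2
    rw [map_neg, Bialgebra.counit_one, eq_neg_iff_add_eq_zero, one_add_one_eq_two] at h3
    exact absurd h3 two_ne_zero

end HopfAlgebra

/-- Let `K ⊆ H` be a Hopf subalgebra of a semisimple Hopf algebra over an
algebraically closed field of characteristic zero, with two-sided integrals `Λ_H = Λ_K Λ` and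
`ε(Λ_H) = dim H`, `ε(Λ_K) = dim K`.  Then the components of the dual bases tensor for the
Frobenius extension `H|K` multiply to the index:
`S(Λ₍₂₎) Λ₍₁₎ = ε(Λ) = ε(Λ_H)/ε(Λ_K) = dim H / dim K`. -/
theorem dual_bases_components_multiply_to_index
    (k : Type*) [Field k] [IsAlgClosed k] [CharZero k]
    (H : Type*) [Ring H] [HopfAlgebra k H] [FiniteDimensional k H] [IsSemisimpleRing H]
    (K : Subalgebra k H)
    -- `K` is a Hopf subalgebra
    (hΔ : ∀ x ∈ K, comul (R := k) x ∈
      LinearMap.range (TensorProduct.map K.val.toLinearMap K.val.toLinearMap))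
    (hSK : ∀ x ∈ K, antipode (R := k) x ∈ K)
    -- two-sided integrals `Λ_H` of `H` and `Λ_K` of `K`, with `Λ_H = Λ_K Λ`
    (ΛH ΛK Λ : H) (hΛKK : ΛK ∈ K)
    (hΛHl : ∀ a : H, a * ΛH = (counit (R := k) a : k) • ΛH)
    (hΛHr : ∀ a : H, ΛH * a = (counit (R := k) a : k) • ΛH)
    (hΛKl : ∀ x ∈ K, x * ΛK = (counit (R := k) x : k) • ΛK)
    (hΛKr : ∀ x ∈ K, ΛK * x = (counit (R := k) x : k) • ΛK)
    (hfact : ΛH = ΛK * Λ)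
    (hεΛH : (counit (R := k) ΛH : k) = (Module.finrank k H : k))
    (hεΛK : (counit (R := k) ΛK : k) = (Module.finrank k K : k)) :
    -- `S(Λ₍₂₎) Λ₍₁₎ = ε(Λ) • 1` and `ε(Λ) = dim H / dim K`
    LinearMap.mul' k H
        ((TensorProduct.map (antipode (R := k)) LinearMap.id)
          (TensorProduct.comm k H H (comul (R := k) Λ)))
      = (counit (R := k) Λ : k) • (1 : H) ∧
    (counit (R := k) Λ : k) = (Module.finrank k H : k) / (Module.finrank k K : k) := by
  have hnontriv : Nontrivial H := by
    refine nontrivial_of_ne 1 0 fun h => ?_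
    have := congrArg (counit (R := k)) h
    simp at this
  have hε : (counit (R := k) ΛH : k) ≠ 0 := by
    rw [hεΛH]
    exact_mod_cast Module.finrank_pos.ne'
  have hSS := antipode_antipode_of_isSemisimpleRing hΛHl hΛHr hε
  constructor
  · have h1 := sum_antipode_mul_eq_smul (ℛ k Λ)
    have h2 := congrArg (antipode k) h1
    rw [map_smul, antipode_one] at h2
    rw [← h2]
    conv_lhs => rw [← (ℛ k Λ).eq]
    simp [antipode_mul_antidistrib, hSS]
  · have hK : (Module.finrank k K : k) ≠ 0 := by exact_mod_cast Module.finrank_pos.ne'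
    rw [eq_div_iff hK, ← hεΛH, ← hεΛK, hfact, Bialgebra.counit_mul, mul_comm]
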